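/- Let (X,T) be any topological dynamical system on a compact metric space, r ≥ 1, Φ : X^r → ℝ continuous, and α ∈ ℝ with E_Φ(α) ≠ ∅. Then h_top(E_Φ(α)) ≤ sup_{μ ∈ M_Φ(α)} h_μ. (No saturation assumption is needed for this inequality.) -/

import Mathlib

open MeasureTheory Filter Topology
open scoped ENNReal NNReal

section Defs

variable {X : Type*} [MetricSpace X]

/-- The Bowen ball `B_n(x, ε)` for the dynamics `T`. -/
def bowenBall (T : X → X) (n : ℕ) (ε : ℝ) (x : X) : Set X :=
  {y | ∀ j < n, dist (T^[j] x) (T^[j] y) < ε}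

/-- `H^s_n(Z, ε)`: infimum of `∑ exp(-s n_i)` over countable covers of `Z` by Bowen balls
`B_{n_i}(x_i, ε)` with `n_i ≥ n`. -/
noncomputable def bowenHn (T : X → X) (Z : Set X) (s ε : ℝ) (n : ℕ) : ℝ≥0∞ :=
  ⨅ (c : ℕ → X × ℕ) (_ : Z ⊆ ⋃ i, bowenBall T (c i).2 ε (c i).1) (_ : ∀ i, n ≤ (c i).2),
    ∑' i, ENNReal.ofReal (Real.exp (-(s * ((c i).2 : ℝ))))

/-- `H^s(Z, ε) = lim_n H^s_n(Z, ε)` (the quantities are nondecreasing in `n`). -/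
noncomputable def bowenH (T : X → X) (Z : Set X) (s ε : ℝ) : ℝ≥0∞ :=
  ⨆ n : ℕ, bowenHn T Z s ε n

/-- `h_top(Z, ε)`: the critical value of `s ↦ H^s(Z, ε)`. -/
noncomputable def bowenEnt (T : X → X) (Z : Set X) (ε : ℝ) : ℝ≥0∞ :=
  ⨅ (s : ℝ≥0) (_ : bowenH T Z s ε = 0), (s : ℝ≥0∞)

/-- Bowen's topological entropy of an arbitrary subset `Z ⊆ X`:
`h_top(Z) = lim_{ε → 0} h_top(Z, ε)`. -/
noncomputable def htop (T : X → X) (Z : Set X) : ℝ≥0∞ :=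
  ⨆ (ε : ℝ) (_ : 0 < ε), bowenEnt T Z ε

variable [MeasurableSpace X]

/-- Shannon entropy of the finite measurable partition of `X` induced by `P : X → ι`. -/
noncomputable def partEntropy {ι : Type} [Fintype ι] (μ : Measure X) (P : X → ι) : ℝ :=
  ∑ i : ι, Real.negMulLog ((μ (P ⁻¹' {i})).toReal)

/-- The measure-theoretic (Kolmogorov–Sinai) entropy `h_μ(T)`: supremum over finite measurable
partitions `P` of `lim_n (1/n) H_μ(P ∨ T⁻¹P ∨ ⋯ ∨ T^{-(n-1)}P)`, the limit being the
infimum by subadditivity. -/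
noncomputable def hKS (T : X → X) (μ : Measure X) : ℝ≥0∞ :=
  ⨆ (k : ℕ) (P : X → Fin k) (_ : Measurable P),
    ENNReal.ofReal (⨅ n : ℕ,
      partEntropy μ (fun x => fun j : Fin (n + 1) => P (T^[(j : ℕ)] x)) / (n + 1))

/-- The V-statistics `V_Φ(n, x) = n^{-r} ∑_{1 ≤ i_1, …, i_r ≤ n} Φ(T^{i_1}x, …, T^{i_r}x)`. -/
noncomputable def Vstat {r : ℕ} (T : X → X) (Φ : (Fin r → X) → ℝ) (n : ℕ) (x : X) : ℝ :=
  (∑ i : Fin r → Fin n, Φ (fun j => T^[(i j : ℕ) + 1] x)) / (n : ℝ) ^ r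

/-- The level set `E_Φ(α) = {x : lim_n V_Φ(n,x) = α}`. -/
def Eset {r : ℕ} (T : X → X) (Φ : (Fin r → X) → ℝ) (α : ℝ) : Set X :=
  {x | Tendsto (fun n => Vstat T Φ n x) atTop (𝓝 α)}

/-- The fiber `M_Φ(α)`: the `T`-invariant Borel probability measures `μ` with
`∫_{X^r} Φ dμ^{⊗r} = α`. -/
def Mset {r : ℕ} (T : X → X) (Φ : (Fin r → X) → ℝ) (α : ℝ) : Set (Measure X) :=
  {μ | IsProbabilityMeasure μ ∧ MeasurePreserving T μ μ ∧
    ∫ y, Φ y ∂(Measure.pi fun _ : Fin r => μ) = α}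

end Defs

section BowenCover

variable {X : Type*} [MetricSpace X]

theorem bowenHn_le_tsum [Nonempty X] (T : X → X) (Z : Set X) (s ε : ℝ) (hs : 0 < s) (N : ℕ)
    {ι : Type*} [Countable ι] (c : ι → X × ℕ)
    (hc : Z ⊆ ⋃ i, bowenBall T (c i).2 ε (c i).1) (hN : ∀ i, N ≤ (c i).2) :
    bowenHn T Z s ε N ≤ ∑' i, ENNReal.ofReal (Real.exp (-(s * ((c i).2 : ℝ)))) := by
  refine ENNReal.le_of_forall_pos_le_add ?_
  intro η hη _
  have x0 : X := Classical.arbitrary X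
  have hsum : Summable (fun i : ℕ => Real.exp (-(s * (i : ℝ)))) := by
    have := Real.summable_exp_nat_mul_iff (a := -s)
    have h2 := this.2 (by linarith)
    refine h2.congr ?_
    intro i
    congr 1
    ring
  have hpad : Tendsto (fun M : ℕ => ∑' i : ℕ, ENNReal.ofReal (Real.exp (-(s * ((i + M : ℕ) : ℝ)))))
      atTop (𝓝 0) := by
    refine ENNReal.tendsto_sum_nat_add (fun i : ℕ => ENNReal.ofReal (Real.exp (-(s * (i : ℝ))))) ?_
    rw [← ENNReal.ofReal_tsum_of_nonneg (fun i => (Real.exp_pos _).le) hsum]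
    exact ENNReal.ofReal_ne_top
  have hev := (hpad.eventually (gt_mem_nhds (show (0 : ℝ≥0∞) < η by exact_mod_cast hη))).and
    (eventually_ge_atTop N)
  obtain ⟨M, hM, hMN⟩ := hev.exists
  let d : ι ⊕ ℕ → X × ℕ := Sum.elim c (fun i => (x0, i + M))
  obtain ⟨e⟩ : Nonempty (ι ⊕ ℕ ≃ ℕ) := by
    obtain ⟨h⟩ := nonempty_denumerable (ι ⊕ ℕ)
    exact ⟨Denumerable.eqv _⟩
  have h1 : bowenHn T Z s ε N ≤
      ∑' i : ℕ, ENNReal.ofReal (Real.exp (-(s * ((d (e.symm i)).2 : ℝ)))) := by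
    unfold bowenHn
    refine iInf_le_of_le (fun i => d (e.symm i)) (iInf_le_of_le ?_ (iInf_le_of_le ?_ le_rfl))
    · intro z hz
      obtain ⟨i, hi⟩ := Set.mem_iUnion.1 (hc hz)
      refine Set.mem_iUnion.2 ⟨e (Sum.inl i), ?_⟩
      simpa [d] using hi
    · have hd : ∀ p, N ≤ (d p).2 := by
        rintro (j | j)
        · exact hN j
        · exact hMN.trans (Nat.le_add_left M j)
      exact fun i => hd _
  refine h1.trans ?_
  rw [e.symm.tsum_eq (fun j => ENNReal.ofReal (Real.exp (-(s * ((d j).2 : ℝ)))))]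
  rw [Summable.tsum_sum ENNReal.summable ENNReal.summable]
  exact add_le_add le_rfl hM.le

theorem bowenHn_iUnion_le [Nonempty X] (T : X → X) (s ε : ℝ) (hs : 0 < s) (N : ℕ)
    {κ : Type*} [Countable κ] (Z : κ → Set X) :
    bowenHn T (⋃ k, Z k) s ε N ≤ ∑' k, bowenHn T (Z k) s ε N := by
  refine ENNReal.le_of_forall_pos_le_add ?_
  intro η hη hfin
  obtain ⟨δ, hδ, hδs⟩ := ENNReal.exists_pos_sum_of_countable
    (show (η : ℝ≥0∞) ≠ 0 by exact_mod_cast hη.ne') κ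
  have hne : ∀ k, bowenHn T (Z k) s ε N ≠ ⊤ := fun k => ENNReal.ne_top_of_tsum_ne_top hfin.ne k
  have hlt : ∀ k, bowenHn T (Z k) s ε N < bowenHn T (Z k) s ε N + δ k := fun k =>
    ENNReal.lt_add_right (hne k) (by exact_mod_cast (hδ k).ne')
  have hex : ∀ k, ∃ c : ℕ → X × ℕ, (Z k ⊆ ⋃ i, bowenBall T (c i).2 ε (c i).1) ∧
      (∀ i, N ≤ (c i).2) ∧ ∑' i, ENNReal.ofReal (Real.exp (-(s * ((c i).2 : ℝ)))) <
        bowenHn T (Z k) s ε N + δ k := by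
    intro k
    have := hlt k
    conv_lhs at this => unfold bowenHn
    simp only [iInf_lt_iff] at this
    obtain ⟨c, h1, h2, h3⟩ := this
    exact ⟨c, h1, h2, h3⟩
  choose c h1 h2 h3 using hex
  calc bowenHn T (⋃ k, Z k) s ε N
      ≤ ∑' p : κ × ℕ, ENNReal.ofReal (Real.exp (-(s * ((c p.1 p.2).2 : ℝ)))) := by
        refine bowenHn_le_tsum T _ s ε hs N (fun p : κ × ℕ => c p.1 p.2) ?_ (fun p => h2 _ _)
        refine Set.iUnion_subset fun k z hz => ?_
        obtain ⟨i, hi⟩ := Set.mem_iUnion.1 (h1 k hz)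
        exact Set.mem_iUnion.2 ⟨(k, i), hi⟩
    _ = ∑' k, ∑' i, ENNReal.ofReal (Real.exp (-(s * ((c k i).2 : ℝ)))) :=
        ENNReal.tsum_prod (f := fun k i => ENNReal.ofReal (Real.exp (-(s * ((c k i).2 : ℝ)))))
    _ ≤ ∑' k, (bowenHn T (Z k) s ε N + δ k) := ENNReal.tsum_le_tsum fun k => (h3 k).le
    _ = ∑' k, bowenHn T (Z k) s ε N + ∑' k, (δ k : ℝ≥0∞) := ENNReal.tsum_add
    _ ≤ _ := add_le_add le_rfl hδs.le

theorem bowenHn_le_single [Nonempty X] (T : X → X) (A : Set X) (s ε : ℝ) (hs : 0 < s) (N L : ℕ)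
    (hL : N ≤ L) (hA : ∀ y ∈ A, A ⊆ bowenBall T L ε y) :
    bowenHn T A s ε N ≤ ENNReal.ofReal (Real.exp (-(s * (L : ℝ)))) := by
  rcases A.eq_empty_or_nonempty with rfl | ⟨y, hy⟩
  · refine (bowenHn_le_tsum T ∅ s ε hs N (fun i : Empty => i.elim) (by simp)
      (fun i => i.elim)).trans ?_
    simp
  · refine (bowenHn_le_tsum T A s ε hs N (fun _ : Unit => (y, L)) ?_ (fun _ => hL)).trans ?_
    · exact (hA y hy).trans (fun z hz => Set.mem_iUnion.2 ⟨(), hz⟩)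
    · simp

theorem bowenHn_mono (T : X → X) {A B : Set X} (h : A ⊆ B) (s ε : ℝ) (N : ℕ) :
    bowenHn T A s ε N ≤ bowenHn T B s ε N := by
  unfold bowenHn
  refine iInf_mono fun c => ?_
  exact le_iInf fun hB => iInf_le_of_le (h.trans hB) le_rfl

end BowenCover

section Counting

variable {X : Type*} [MetricSpace X]

/-- Points having a name with small cross entropy along infinitely many times. -/
def crossSet (T : X → X) {k : ℕ} (ctr : Fin k → X) (ε : ℝ) (m : ℕ)
    (q : (Fin m → Fin k) → ℝ) (u : ℝ) : Set X :=
  {x | ∃ a : ℕ → Fin k, (∀ p, dist (T^[p] x) (ctr (a p)) < ε / 2) ∧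
    ∀ N, ∃ n ≥ N, ∑ p ∈ Finset.range n, -Real.log (q (fun t : Fin m => a (p + 1 + t)))
      ≤ n * (m * u)}

/-- Points with prescribed initial word and blocks. -/
def cellSet (T : X → X) {k : ℕ} (ctr : Fin k → X) (ε : ℝ) (m l : ℕ)
    (d : Fin m × (Fin (m + 1) → Fin k) × (Fin l → Fin m → Fin k)) : Set X :=
  {x | ∃ a : ℕ → Fin k, (∀ p, dist (T^[p] x) (ctr (a p)) < ε / 2) ∧
    (∀ t : Fin (m + 1), a t = d.2.1 t) ∧
    (∀ (i : Fin l) (t : Fin m), a (m * i + d.1 + 1 + t) = d.2.2 i t)}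

theorem cellSet_subset (T : X → X) {k : ℕ} (ctr : Fin k → X) (ε : ℝ) (m l : ℕ)
    (d : Fin m × (Fin (m + 1) → Fin k) × (Fin l → Fin m → Fin k)) (y : X)
    (hy : y ∈ cellSet T ctr ε m l d) :
    cellSet T ctr ε m l d ⊆ bowenBall T (m * l) ε y := by
  rintro z ⟨b, hb1, hb2, hb3⟩
  obtain ⟨a, ha1, ha2, ha3⟩ := hy
  intro p hp
  have hab : a p = b p := by
    by_cases hpm : p < m + 1
    · exact (ha2 ⟨p, hpm⟩).trans (hb2 ⟨p, hpm⟩).symm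
    · have hj := d.1.isLt
      have hm : 0 < m := by omega
      set j : ℕ := (d.1 : ℕ) with hjdef
      obtain ⟨v, hv⟩ : ∃ v, p = v + j + 1 := ⟨p - j - 1, by omega⟩
      have hi : v / m < l := by
        rw [Nat.div_lt_iff_lt_mul hm]
        nlinarith
      have ht : v % m < m := Nat.mod_lt _ hm
      have hdm := Nat.div_add_mod v m
      have e : m * (v / m) + j + 1 + v % m = p := by omega
      have h1 := ha3 ⟨v / m, hi⟩ ⟨v % m, ht⟩
      have h2 := hb3 ⟨v / m, hi⟩ ⟨v % m, ht⟩
      simp only [e] at h1 h2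
      exact h1.trans h2.symm
  have h1 := ha1 p
  have h2 := hb1 p
  rw [← hab] at h2
  calc dist (T^[p] y) (T^[p] z) ≤ dist (T^[p] y) (ctr (a p)) + dist (T^[p] z) (ctr (a p)) :=
        dist_triangle_right _ _ _
    _ < ε := by linarith

/-- Good cells: those with small cross entropy. -/
def goodSet (T : X → X) {k : ℕ} (ctr : Fin k → X) (ε : ℝ) (m : ℕ)
    (q : (Fin m → Fin k) → ℝ) (u : ℝ) (l : ℕ)
    (d : Fin m × (Fin (m + 1) → Fin k) × (Fin l → Fin m → Fin k)) : Set X :=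
  {x | x ∈ cellSet T ctr ε m l d ∧
    ∑ i, -Real.log (q (d.2.2 i)) ≤ (m * (l + 1)) * u}

theorem sum_range_mul_aux (f : ℕ → ℝ) (m l : ℕ) :
    ∑ p ∈ Finset.range (m * l), f p = ∑ j : Fin m, ∑ i : Fin l, f (m * i + j) := by
  induction l with
  | zero => simp
  | succ l ih =>
    rw [Nat.mul_succ, Finset.sum_range_add, ih]
    simp only [Fin.sum_univ_castSucc, Finset.sum_add_distrib, Fin.val_castSucc, Fin.val_last]
    rw [Finset.sum_range]

theorem crossSet_subset (T : X → X) {k : ℕ} (ctr : Fin k → X) (ε : ℝ) (m : ℕ) (hm : 0 < m)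
    (q : (Fin m → Fin k) → ℝ) (hq0 : ∀ b, 0 < q b) (hq1 : ∀ b, q b ≤ 1) (u : ℝ) (hu : 0 ≤ u)
    (M : ℕ) :
    crossSet T ctr ε m q u ⊆ ⋃ l : ℕ, ⋃ d, goodSet T ctr ε m q u (l + M) d := by
  rintro x ⟨a, ha, hN⟩
  obtain ⟨n, hn, hsum⟩ := hN (m * M)
  set f : ℕ → ℝ := fun p => -Real.log (q (fun t : Fin m => a (p + 1 + t))) with hf
  have hf0 : ∀ p, 0 ≤ f p := fun p => by
    have := Real.log_nonpos (hq0 (fun t : Fin m => a (p + 1 + t))).le (hq1 _)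
    simp only [hf]; linarith
  obtain ⟨l, hl⟩ : ∃ l, n / m = l + M :=
    ⟨n / m - M, by have : M ≤ n / m := (Nat.le_div_iff_mul_le hm).2 (by linarith [mul_comm m M]); omega⟩
  have hdm := Nat.div_add_mod n m
  have hlt := Nat.mod_lt n hm
  rw [hl] at hdm
  have h1 : ∑ p ∈ Finset.range (m * (l + M)), f p ≤ n * (m * u) := by
    refine le_trans ?_ hsum
    refine Finset.sum_le_sum_of_subset_of_nonneg ?_ (fun p _ _ => hf0 p)
    exact Finset.range_subset_range.2 (by omega)
  rw [sum_range_mul_aux] at h1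
  have hne : (Finset.univ : Finset (Fin m)).Nonempty := ⟨⟨0, hm⟩, Finset.mem_univ _⟩
  obtain ⟨j, -, hj⟩ := Finset.exists_le_of_sum_le (s := (Finset.univ : Finset (Fin m)))
    (f := fun j : Fin m => ∑ i : Fin (l + M), f (m * i + j)) (g := fun _ => n * u) hne (by
      simp only [Finset.sum_const, Finset.card_univ, Fintype.card_fin, nsmul_eq_mul]
      linarith)
  refine Set.mem_iUnion.2 ⟨l, Set.mem_iUnion.2
    ⟨(j, fun t => a t, fun i t => a (m * i + j + 1 + t)), ⟨a, ha, fun _ => rfl, fun _ _ => rfl⟩, ?_⟩⟩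
  refine hj.trans ?_
  refine mul_le_mul_of_nonneg_right ?_ hu
  have : n ≤ m * ((l + M) + 1) := by
    rw [Nat.mul_succ]; omega
  exact_mod_cast this

theorem bowenHn_good_le [Nonempty X] (T : X → X) {k : ℕ} (ctr : Fin k → X) (ε : ℝ) (m : ℕ)
    (q : (Fin m → Fin k) → ℝ) (hq0 : ∀ b, 0 < q b) (hqs : ∑ b, q b ≤ 1) (u s : ℝ)
    (hs : 0 < s) (N l : ℕ) (hN : N ≤ m * l) :
    bowenHn T (⋃ d, goodSet T ctr ε m q u l d) s ε N ≤
      ENNReal.ofReal ((m * (k : ℝ) ^ (m + 1)) * Real.exp (m * u) *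
        Real.exp (l * (-(m * (s - u))))) := by
  set K : ℝ := Real.exp ((m * (l + 1)) * u) * Real.exp (-(s * ((m * l : ℕ) : ℝ))) with hK
  have hKpos : 0 < K := by positivity
  have hcell : ∀ d, bowenHn T (goodSet T ctr ε m q u l d) s ε N ≤
      ENNReal.ofReal ((∏ i, q (d.2.2 i)) * K) := by
    intro d
    by_cases hd : ∑ i, -Real.log (q (d.2.2 i)) ≤ (m * (l + 1)) * u
    · refine (bowenHn_le_single T _ s ε hs N (m * l) hN ?_).trans ?_
      · intro y hy z hz
        exact cellSet_subset T ctr ε m l d y hy.1 hz.1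
      · refine ENNReal.ofReal_le_ofReal ?_
        have hprod : ∏ i, q (d.2.2 i) = Real.exp (∑ i, Real.log (q (d.2.2 i))) := by
          rw [Real.exp_sum]
          exact Finset.prod_congr rfl fun i _ => (Real.exp_log (hq0 _)).symm
        rw [hprod, hK, ← Real.exp_add, ← Real.exp_add]
        refine Real.exp_le_exp.2 ?_
        rw [Finset.sum_neg_distrib] at hd
        linarith
    · have : goodSet T ctr ε m q u l d = ∅ := by
        ext x; simp only [goodSet, Set.mem_ofPred_eq, Set.mem_empty_iff_false, iff_false]
        exact fun h => hd h.2
      rw [this]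
      refine (bowenHn_le_tsum T ∅ s ε hs N (fun i : Empty => i.elim) (by simp)
        (fun i => i.elim)).trans ?_
      simp
  refine (bowenHn_iUnion_le T s ε hs N _).trans ?_
  refine (ENNReal.tsum_le_tsum hcell).trans ?_
  have hp : ∀ d : Fin m × (Fin (m + 1) → Fin k) × (Fin l → Fin m → Fin k),
      0 ≤ (∏ i, q (d.2.2 i)) * K := fun d =>
    mul_nonneg (Finset.prod_nonneg fun i _ => (hq0 _).le) hKpos.le
  rw [tsum_fintype, ← ENNReal.ofReal_sum_of_nonneg (fun d _ => hp d)]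
  refine ENNReal.ofReal_le_ofReal ?_
  rw [← Finset.sum_mul, Fintype.sum_prod_type]
  simp only [Fintype.sum_prod_type, ← Fintype.sum_pow, Finset.sum_const, Finset.card_univ,
    Fintype.card_fin, Fintype.card_fun, nsmul_eq_mul]
  have hpow : (∑ b, q b) ^ l ≤ 1 := pow_le_one₀ (Finset.sum_nonneg fun b _ => (hq0 b).le) hqs
  have hKe : K = Real.exp (m * u) * Real.exp (l * (-(m * (s - u)))) := by
    rw [hK, ← Real.exp_add, ← Real.exp_add]
    congr 1
    push_cast
    ring
  rw [mul_assoc (m * (k : ℝ) ^ (m + 1)), ← hKe]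
  push_cast
  rw [← mul_assoc (m : ℝ)]
  refine mul_le_mul_of_nonneg_right ?_ hKpos.le
  exact mul_le_of_le_one_right (by positivity) hpow

theorem bowenHn_crossSet [Nonempty X] (T : X → X) {k : ℕ} (ctr : Fin k → X) (ε : ℝ) (m : ℕ)
    (hm : 0 < m) (q : (Fin m → Fin k) → ℝ) (hq0 : ∀ b, 0 < q b) (hqs : ∑ b, q b ≤ 1) (u s : ℝ)
    (hu : 0 ≤ u) (hus : u < s) (N : ℕ) :
    bowenHn T (crossSet T ctr ε m q u) s ε N = 0 := by
  have hq1 : ∀ b, q b ≤ 1 := fun b =>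
    (Finset.single_le_sum (fun b _ => (hq0 b).le) (Finset.mem_univ b)).trans hqs
  have hs : 0 < s := lt_of_le_of_lt hu hus
  set g : ℕ → ℝ := fun l => (m * (k : ℝ) ^ (m + 1)) * Real.exp (m * u) *
        Real.exp (l * (-(m * (s - u)))) with hg
  have hm' : (0 : ℝ) < m := by exact_mod_cast hm
  have hsum : Summable g := by
    refine Summable.mul_left _ ?_
    exact Real.summable_exp_nat_mul_iff.2 (by nlinarith)
  have hlim : Tendsto (fun M : ℕ => ∑' l : ℕ, ENNReal.ofReal (g (l + M))) atTop (𝓝 0) := by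
    refine ENNReal.tendsto_sum_nat_add (fun l => ENNReal.ofReal (g l)) ?_
    rw [← ENNReal.ofReal_tsum_of_nonneg (fun i => by positivity) hsum]
    exact ENNReal.ofReal_ne_top
  refine le_antisymm (ge_of_tendsto hlim ?_) zero_le
  filter_upwards [eventually_ge_atTop N] with M hM
  refine (bowenHn_mono T (crossSet_subset T ctr ε m hm q hq0 hq1 u hu M) s ε N).trans ?_
  refine (bowenHn_iUnion_le T s ε hs N _).trans ?_
  refine ENNReal.tsum_le_tsum fun l => ?_
  exact bowenHn_good_le T ctr ε m q hq0 hqs u s hs N (l + M) (by nlinarith)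

end Counting

theorem exists_rat_weights {β : Type*} [Fintype β] (w : β → ℝ) (hw0 : ∀ b, 0 ≤ w b)
    (hw1 : ∑ b, w b = 1) (c : ℝ) (hc : ∑ b, Real.negMulLog (w b) < c) :
    ∃ q : β → ℚ, (∀ b, (0 : ℝ) < q b) ∧ ∑ b, (q b : ℝ) ≤ 1 ∧
      ∑ b, w b * (-Real.log (q b)) < c := by
  set σ := c - ∑ b, Real.negMulLog (w b) with hσ
  have hσ0 : 0 < σ := by linarith
  set K : ℝ := (Fintype.card β : ℝ) with hK
  have hK0 : 0 ≤ K := by positivity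
  have he : 0 < Real.exp σ - 1 := by linarith [Real.one_lt_exp_iff.2 hσ0]
  set η : ℝ := (Real.exp σ - 1) / (2 * (K + 1)) with hη
  have hη0 : 0 < η := by positivity
  have hηe : 2 * η * (K + 1) = Real.exp σ - 1 := by
    rw [hη]; field_simp
  set D : ℝ := 1 + 2 * K * η with hD
  have hD0 : 0 < D := by positivity
  have hDe : D < Real.exp σ := by rw [hD]; nlinarith
  have hex : ∀ b, ∃ q : ℚ, (w b + η) / D < q ∧ (q : ℝ) < (w b + 2 * η) / D := fun b =>
    exists_rat_btwn (div_lt_div_of_pos_right (by linarith) hD0)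
  choose q hq1 hq2 using hex
  have hq0 : ∀ b, (0 : ℝ) < q b := fun b =>
    lt_trans (div_pos (by linarith [hw0 b]) hD0) (hq1 b)
  refine ⟨q, hq0, ?_, ?_⟩
  · calc ∑ b, (q b : ℝ) ≤ ∑ b, (w b + 2 * η) / D := Finset.sum_le_sum fun b _ => (hq2 b).le
      _ = 1 := by
        rw [← Finset.sum_div, Finset.sum_add_distrib, hw1, Finset.sum_const, Finset.card_univ,
          nsmul_eq_mul, div_eq_one_iff_eq hD0.ne', hD, hK]
        ring
  · have hle : ∀ b, w b * (-Real.log (q b)) ≤ Real.negMulLog (w b) + w b * Real.log D := by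
      intro b
      rcases (hw0 b).eq_or_lt with h | h
      · simp [← h]
      · have h1 : Real.log (w b / D) ≤ Real.log (q b) := by
          refine Real.log_le_log (by positivity) ((le_of_lt ?_).trans (hq1 b).le)
          exact div_lt_div_of_pos_right (by linarith) hD0
        rw [Real.log_div h.ne' hD0.ne'] at h1
        simp only [Real.negMulLog]
        nlinarith
    calc ∑ b, w b * (-Real.log (q b)) ≤ ∑ b, (Real.negMulLog (w b) + w b * Real.log D) :=
          Finset.sum_le_sum fun b _ => hle b
      _ = ∑ b, Real.negMulLog (w b) + Real.log D := by
          rw [Finset.sum_add_distrib, ← Finset.sum_mul, hw1, one_mul]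
      _ < c := by
          have : Real.log D < σ := (Real.log_lt_iff_lt_exp hD0).2 hDe
          linarith

section Empirical

variable {X : Type*} [MetricSpace X] [MeasurableSpace X]

/-- Uniform measure on `Fin (n+1)`. -/
noncomputable def unifM (n : ℕ) : Measure (Fin (n + 1)) :=
  ((n + 1 : ℕ) : ℝ≥0∞)⁻¹ • Measure.count

instance unifM_prob (n : ℕ) : IsProbabilityMeasure (unifM n) := by
  constructor
  simp only [unifM, Measure.smul_apply, smul_eq_mul, Measure.count_univ, ENat.card_eq_coe_fintype_card,
    Fintype.card_fin]
  exact ENNReal.inv_mul_cancel (by simp) (by simp)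

theorem unifM_singleton (n : ℕ) (p : Fin (n + 1)) :
    unifM n {p} = ((n + 1 : ℕ) : ℝ≥0∞)⁻¹ := by
  simp [unifM, Measure.smul_apply]

/-- Empirical measure of `Tx, …, T^{n+1}x`. -/
noncomputable def empM (T : X → X) (x : X) (n : ℕ) : ProbabilityMeasure X :=
  ⟨(unifM n).map (fun p : Fin (n + 1) => T^[(p : ℕ) + 1] x),
    Measure.isProbabilityMeasure_map (measurable_of_finite _).aemeasurable⟩

theorem empM_integral (T : X → X) (x : X) (n : ℕ) (f : X → ℝ) (hf : StronglyMeasurable f) :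
    ∫ y, f y ∂(empM T x n : Measure X) =
      (∑ p ∈ Finset.range (n + 1), f (T^[p + 1] x)) / (n + 1) := by
  have : (empM T x n : Measure X) = (unifM n).map (fun p : Fin (n + 1) => T^[(p : ℕ) + 1] x) := rfl
  rw [this, integral_map (measurable_of_finite _).aemeasurable hf.aestronglyMeasurable,
    integral_fintype .of_finite, Finset.sum_range, Finset.sum_div]
  refine Finset.sum_congr rfl fun p _ => ?_
  rw [Measure.real, unifM_singleton, ENNReal.toReal_inv, ENNReal.toReal_natCast, smul_eq_mul]
  push_cast
  rw [inv_mul_eq_div]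

theorem empM_pi_integral [CompactSpace X] [BorelSpace X] (T : X → X) (x : X) (n r : ℕ)
    (Φ : (Fin r → X) → ℝ) (hΦ : Continuous Φ) :
    ∫ y, Φ y ∂(Measure.pi fun _ : Fin r => (empM T x n : Measure X)) = Vstat T Φ (n + 1) x := by
  have : (empM T x n : Measure X) = (unifM n).map (fun p : Fin (n + 1) => T^[(p : ℕ) + 1] x) := rfl
  rw [this]
  have hsig : ∀ _ : Fin r, SigmaFinite ((unifM n).map (fun p : Fin (n + 1) => T^[(p : ℕ) + 1] x)) := fun _ => by
    rw [← this]; infer_instance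
  rw [← Measure.pi_map_pi (fun _ => (measurable_of_finite _).aemeasurable),
    integral_map (measurable_of_finite _).aemeasurable hΦ.stronglyMeasurable.aestronglyMeasurable,
    integral_fintype .of_finite, Vstat, Finset.sum_div]
  refine Finset.sum_congr rfl fun p _ => ?_
  rw [Measure.real, Measure.pi_singleton]
  simp only [unifM_singleton, Finset.prod_const, Finset.card_univ, Fintype.card_fin,
    ENNReal.toReal_pow, ENNReal.toReal_inv, ENNReal.toReal_natCast, smul_eq_mul]
  rw [inv_pow, inv_mul_eq_div]

theorem exists_limit [CompactSpace X] [BorelSpace X] (T : X → X) (hT : Continuous T) (r : ℕ)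
    (Φ : (Fin r → X) → ℝ) (hΦ : Continuous Φ) (α : ℝ) (x : X) (hx : x ∈ Eset T Φ α) :
    ∃ μ : ProbabilityMeasure X, (μ : Measure X) ∈ Mset T Φ α ∧
      Tendsto (empM T x) (hyperfilter ℕ : Filter ℕ) (𝓝 μ) := by
  obtain ⟨μ, -, hμ⟩ := (isCompact_univ (X := ProbabilityMeasure X)).ultrafilter_le_nhds
    ((hyperfilter ℕ).map (empM T x)) (by simp)
  have hlim : Tendsto (empM T x) (hyperfilter ℕ : Filter ℕ) (𝓝 μ) := hμ
  have hat : (hyperfilter ℕ : Filter ℕ) ≤ atTop := Nat.hyperfilter_le_atTop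
  refine ⟨μ, ⟨inferInstance, ⟨hT.measurable, ?_⟩, ?_⟩, hlim⟩
  · have : IsProbabilityMeasure ((μ : Measure X).map T) :=
      Measure.isProbabilityMeasure_map hT.measurable.aemeasurable
    refine ext_of_forall_integral_eq_of_IsFiniteMeasure fun f => ?_
    rw [integral_map hT.measurable.aemeasurable f.continuous.aestronglyMeasurable]
    have h1 := (ProbabilityMeasure.tendsto_iff_forall_integral_tendsto.1 hlim) f
    have h2 := (ProbabilityMeasure.tendsto_iff_forall_integral_tendsto.1 hlim)
      (f.compContinuous ⟨T, hT⟩)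
    have h3 : Tendsto (fun n : ℕ => (f (T^[n + 2] x) - f (T x)) / ((n : ℝ) + 1)) atTop (𝓝 0) := by
      have hb : Tendsto (fun n : ℕ => (2 * ‖f‖) / ((n : ℝ) + 1)) atTop (𝓝 0) :=
        tendsto_const_nhds.div_atTop
          (tendsto_atTop_add_const_right _ _ tendsto_natCast_atTop_atTop)
      refine squeeze_zero_norm (fun n => ?_) hb
      rw [norm_div]
      have : ‖((n : ℝ) + 1)‖ = (n : ℝ) + 1 := Real.norm_of_nonneg (by positivity)
      rw [this]
      refine div_le_div_of_nonneg_right ?_ (by positivity)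
      calc ‖f (T^[n + 2] x) - f (T x)‖ ≤ ‖f (T^[n + 2] x)‖ + ‖f (T x)‖ := norm_sub_le _ _
        _ ≤ 2 * ‖f‖ := by linarith [f.norm_coe_le_norm (T^[n + 2] x), f.norm_coe_le_norm (T x)]
    have h4 := h2.sub h1
    have h5 : (fun n => ∫ y, (f.compContinuous ⟨T, hT⟩) y ∂(empM T x n : Measure X) -
        ∫ y, f y ∂(empM T x n : Measure X)) =
        fun n : ℕ => (f (T^[n + 2] x) - f (T x)) / ((n : ℝ) + 1) := by
      funext n
      rw [empM_integral _ _ _ _ (f.compContinuous ⟨T, hT⟩).continuous.stronglyMeasurable,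
        empM_integral _ _ _ _ f.continuous.stronglyMeasurable, ← sub_div, ← Finset.sum_sub_distrib]
      congr 1
      have := Finset.sum_range_sub (fun p => f (T^[p + 1] x)) (n + 1)
      simp only [zero_add, Function.iterate_one] at this
      rw [← this]
      refine Finset.sum_congr rfl fun p _ => ?_
      simp only [BoundedContinuousFunction.compContinuous_apply, ContinuousMap.coe_mk]
      rw [← Function.iterate_succ_apply' T (p + 1) x]
    rw [h5] at h4
    have h6 := tendsto_nhds_unique h4 (h3.mono_left hat)
    simp only [BoundedContinuousFunction.compContinuous_apply, ContinuousMap.coe_mk] at h6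
    linarith
  · have hpi : Tendsto (fun n => ProbabilityMeasure.pi (fun _ : Fin r => empM T x n))
        (hyperfilter ℕ : Filter ℕ) (𝓝 (ProbabilityMeasure.pi (fun _ : Fin r => μ))) := by
      have hc := ProbabilityMeasure.continuous_pi (ι := Fin r) (α := fun _ => X)
      exact (hc.tendsto (fun _ => μ)).comp (tendsto_pi_nhds.2 fun _ => hlim)
    have h1 := (ProbabilityMeasure.tendsto_iff_forall_integral_tendsto.1 hpi)
      (BoundedContinuousFunction.mkOfCompact ⟨Φ, hΦ⟩)
    simp only [BoundedContinuousFunction.mkOfCompact_apply, ContinuousMap.coe_mk,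
      ProbabilityMeasure.toMeasure_pi, empM_pi_integral T x _ r Φ hΦ] at h1
    have h2 : Tendsto (fun n => Vstat T Φ (n + 1) x) (hyperfilter ℕ : Filter ℕ) (𝓝 α) :=
      ((tendsto_add_atTop_iff_nat 1).2 hx).mono_left hat
    exact tendsto_nhds_unique h1 h2

end Empirical

section Partition

variable {X : Type*} [MetricSpace X] [MeasurableSpace X] [BorelSpace X]

/-- A measurable partition subordinate to small balls around a net, locally constant off a closed
null set. -/
theorem exists_partition {k : ℕ} (ctr : Fin k → X) (ε : ℝ) (hε : 0 < ε)
    (hnet : ∀ y, ∃ i, dist y (ctr i) < ε / 4) (μ : Measure X) [IsProbabilityMeasure μ] :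
    ∃ (P : X → Fin k) (F : Set X), Measurable P ∧ (∀ y, dist y (ctr (P y)) < ε / 2) ∧
      MeasurableSet F ∧ μ F = 0 ∧ ∀ y ∉ F, ∀ᶠ z in 𝓝 y, P z = P y := by
  classical
  have hrad : ∀ i, ∃ ρ ∈ Set.Ioo (ε / 4) (ε / 2),
      μ (frontier (Metric.thickening ρ {ctr i})) = 0 := fun i =>
    exists_null_frontier_thickening μ {ctr i} (by linarith)
  choose ρ hρ hfr using hrad
  set B : Fin k → Set X := fun i => Metric.thickening (ρ i) {ctr i} with hB
  have hBmem : ∀ i y, y ∈ B i ↔ dist y (ctr i) < ρ i := fun i y => by simp [hB]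
  have hne : ∀ y, {i | y ∈ B i}.Nonempty := fun y => by
    obtain ⟨i, hi⟩ := hnet y
    exact ⟨i, (hBmem i y).2 (hi.trans (hρ i).1)⟩
  let f : X → Set (Fin k) := fun y => {i | y ∈ B i}
  have hfm : Measurable f := by
    refine measurable_set_iff.2 fun i => ?_
    exact measurable_mem.2 (Metric.isOpen_thickening.measurableSet) 
  have hex : ∃ sel : Set (Fin k) → Fin k, ∀ y, sel (f y) ∈ f y := by
    by_cases hX : Nonempty X
    · obtain ⟨y0⟩ := hX
      have i0 : Fin k := (hne y0).some
      refine ⟨fun S => if h : S.Nonempty then h.some else i0, fun y => ?_⟩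
      have hfy : (f y).Nonempty := hne y
      simp only [dif_pos hfy]
      exact hfy.some_mem
    · exfalso
      have := μ.nonempty_of_neZero
      exact hX this
  obtain ⟨sel, hsel⟩ := hex
  refine ⟨fun y => sel (f y), ⋃ i, frontier (B i), ?_, ?_, ?_, ?_, ?_⟩
  · exact (measurable_of_countable sel).comp hfm
  · intro y
    exact ((hBmem _ _).1 (hsel y)).trans (hρ _).2
  · exact MeasurableSet.iUnion fun i => isClosed_frontier.measurableSet
  · exact measure_iUnion_null hfr
  · intro y hy
    have hi : ∀ i, ∀ᶠ z in 𝓝 y, (z ∈ B i ↔ y ∈ B i) := by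
      intro i
      have hyi : y ∉ frontier (B i) := fun h => hy (Set.mem_iUnion.2 ⟨i, h⟩)
      by_cases h : y ∈ B i
      · filter_upwards [Metric.isOpen_thickening.mem_nhds h] with z hz
        exact ⟨fun _ => h, fun _ => hz⟩
      · have hcl : y ∉ closure (B i) := fun hc => hyi ⟨hc, fun hy2 => h (interior_subset hy2)⟩
        filter_upwards [isClosed_closure.isOpen_compl.mem_nhds hcl] with z hz
        exact ⟨fun hz' => absurd (subset_closure hz') hz, fun h' => absurd h' h⟩
    filter_upwards [eventually_all.2 hi] with z hz
    have : f z = f y := Set.ext hz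
    rw [this]

theorem mem_crossSet (T : X → X) (hT : Continuous T) {k : ℕ} (ctr : Fin k → X) (ε : ℝ)
    (hε : 0 < ε) (hnet : ∀ y, ∃ i, dist y (ctr i) < ε / 4) (μ : ProbabilityMeasure X)
    (hinv : MeasurePreserving T (μ : Measure X) μ) (x : X)
    (hlim : Tendsto (empM T x) (hyperfilter ℕ : Filter ℕ) (𝓝 μ)) (t u : ℝ≥0) (htu : t < u)
    (hent : hKS T (μ : Measure X) ≤ t) :
    ∃ (m : ℕ) (q : (Fin (m + 1) → Fin k) → ℚ), (∀ b, (0 : ℝ) < q b) ∧ ∑ b, (q b : ℝ) ≤ 1 ∧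
      x ∈ crossSet T ctr ε (m + 1) (fun b => (q b : ℝ)) u := by
  obtain ⟨P, F, hPm, hPd, hFm, hF0, hloc⟩ := exists_partition ctr ε hε hnet (μ : Measure X)
  have h1 : ENNReal.ofReal (⨅ n : ℕ,
      partEntropy (μ : Measure X) (fun x => fun j : Fin (n + 1) => P (T^[(j : ℕ)] x)) / (n + 1))
      ≤ t := by
    refine le_trans ?_ hent
    unfold hKS
    exact le_iSup_of_le k (le_iSup_of_le P (le_iSup_of_le hPm le_rfl))
  have h2 : (⨅ n : ℕ,
      partEntropy (μ : Measure X) (fun x => fun j : Fin (n + 1) => P (T^[(j : ℕ)] x)) / (n + 1))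
      < (u : ℝ) := by
    rw [← ENNReal.ofReal_coe_nnreal, ENNReal.ofReal_le_ofReal_iff t.coe_nonneg] at h1
    exact lt_of_le_of_lt h1 (by exact_mod_cast htu)
  obtain ⟨m, hm⟩ := exists_lt_of_ciInf_lt h2
  have hm' : partEntropy (μ : Measure X) (fun x => fun j : Fin (m + 1) => P (T^[(j : ℕ)] x)) <
      ((m + 1 : ℕ) : ℝ) * u := by
    rw [div_lt_iff₀ (by positivity)] at hm
    push_cast; linarith
  set Q : X → (Fin (m + 1) → Fin k) := fun y j => P (T^[(j : ℕ)] y) with hQ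
  have hQm : Measurable Q := measurable_pi_lambda _ fun j => hPm.comp (hT.iterate j).measurable
  have hfr : ∀ b, μ (frontier (Q ⁻¹' {b})) = 0 := by
    intro b
    rw [ProbabilityMeasure.null_iff_toMeasure_null]
    have hsub : frontier (Q ⁻¹' {b}) ⊆ ⋃ j : Fin (m + 1), T^[(j : ℕ)] ⁻¹' F := by
      intro y hy
      by_contra hcon
      simp only [Set.mem_iUnion, Set.mem_preimage, not_exists] at hcon
      have hQloc : ∀ᶠ z in 𝓝 y, Q z = Q y := by
        have : ∀ j : Fin (m + 1), ∀ᶠ z in 𝓝 y, P (T^[(j : ℕ)] z) = P (T^[(j : ℕ)] y) := fun j =>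
          ((hT.iterate j).tendsto y).eventually (hloc _ (hcon j))
        filter_upwards [eventually_all.2 this] with z hz
        exact funext hz
      by_cases hb : Q y = b
      · refine hy.2 (mem_interior_iff_mem_nhds.2 ?_)
        filter_upwards [hQloc] with z hz
        exact hz.trans hb
      · obtain ⟨z, hz1, hz2⟩ := mem_closure_iff_nhds.1 hy.1 _ hQloc
        exact hb ((show Q z = Q y from hz1).symm.trans hz2)
    refine measure_mono_null hsub (measure_iUnion_null fun j => ?_)
    rw [(hinv.iterate j).measure_preimage hFm.nullMeasurableSet]
    exact hF0
  set w : (Fin (m + 1) → Fin k) → ℝ := fun b => ((μ : Measure X) (Q ⁻¹' {b})).toReal with hw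
  have hmapint : ∀ (ν : ProbabilityMeasure X) (g : (Fin (m + 1) → Fin k) → ℝ),
      ∫ y, g (Q y) ∂(ν : Measure X) = ∑ b, (ν (Q ⁻¹' {b}) : ℝ) * g b := by
    intro ν g
    have : IsProbabilityMeasure ((ν : Measure X).map Q) :=
      Measure.isProbabilityMeasure_map hQm.aemeasurable
    rw [← integral_map (φ := Q) (f := g) hQm.aemeasurable
      (measurable_of_finite g).aestronglyMeasurable, integral_fintype .of_finite]
    refine Finset.sum_congr rfl fun b _ => ?_
    rw [Measure.real, Measure.map_apply hQm (measurableSet_singleton b), smul_eq_mul]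
    rfl
  have hw1 : ∑ b, w b = 1 := by
    have := hmapint μ (fun _ => 1)
    simp only [mul_one, integral_const, probReal_univ, smul_eq_mul] at this
    exact this.symm
  obtain ⟨q, hq0, hqs, hqc⟩ := exists_rat_weights w (fun b => ENNReal.toReal_nonneg) hw1
    (((m + 1 : ℕ) : ℝ) * u) hm'
  refine ⟨m, q, hq0, hqs, fun p => P (T^[p] x), fun p => hPd _, fun N => ?_⟩
  have hconv : Tendsto (fun n => ∫ y, -Real.log (q (Q y)) ∂(empM T x n : Measure X))
      (hyperfilter ℕ : Filter ℕ) (𝓝 (∑ b, w b * (-Real.log (q b)))) := by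
    simp only [fun n => hmapint (empM T x n) (fun b => -Real.log (q b))]
    refine tendsto_finsetSum _ fun b _ => Tendsto.mul_const _ ?_
    have := ProbabilityMeasure.tendsto_measure_of_null_frontier_of_tendsto hlim (hfr b)
    exact (NNReal.tendsto_coe.2 this)
  have hev := (hconv.eventually (gt_mem_nhds hqc)).and
    (Nat.hyperfilter_le_atTop (eventually_ge_atTop N))
  obtain ⟨n, hn, hnN⟩ := hev.exists
  refine ⟨n + 1, by omega, ?_⟩
  rw [empM_integral T x n (fun y => -Real.log (q (Q y) : ℝ))
    ((measurable_of_finite (fun b => -Real.log (q b : ℝ))).comp hQm).stronglyMeasurable,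
    div_lt_iff₀ (by positivity)] at hn
  refine le_of_eq_of_le ?_ (hn.le.trans (le_of_eq ?_))
  · refine Finset.sum_congr rfl fun p _ => ?_
    simp only [hQ]
    congr 3
    have : (fun j : Fin (m + 1) => P (T^[(j : ℕ)] (T^[p + 1] x))) =
        fun j : Fin (m + 1) => P (T^[p + 1 + j] x) := by
      funext j
      rw [← Function.iterate_add_apply, add_comm]
    rw [this]
  · push_cast; ring

end Partition

/-- On any system (no saturation needed), if `E_Φ(α) ≠ ∅` then
`h_top(E_Φ(α)) ≤ sup_{μ ∈ M_Φ(α)} h_μ`. -/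
theorem htop_Eset_le_iSup_hKS
    {X : Type*} [MetricSpace X] [CompactSpace X] [MeasurableSpace X] [BorelSpace X]
    (T : X → X) (hT : Continuous T) (r : ℕ) (hr : 1 ≤ r)
    (Φ : (Fin r → X) → ℝ) (hΦ : Continuous Φ) (α : ℝ)
    (hE : (Eset T Φ α).Nonempty) :
    htop T (Eset T Φ α) ≤ ⨆ μ ∈ Mset T Φ α, hKS T μ := by
  classical
  obtain ⟨x0, hx0⟩ := hE
  have hXne : Nonempty X := ⟨x0⟩
  refine iSup₂_le fun ε hε => ?_
  refine le_of_forall_gt_imp_ge_of_dense fun s' hs' => ?_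
  rcases eq_or_ne s' ⊤ with rfl | hs'top
  · exact le_top
  lift s' to ℝ≥0 using hs'top
  obtain ⟨u', hu1, hu2⟩ := exists_between hs'
  lift u' to ℝ≥0 using (hu2.trans_le le_top).ne
  have htop' : (⨆ μ ∈ Mset T Φ α, hKS T μ) ≠ ⊤ := (hu1.trans_le le_top).ne
  obtain ⟨t, ht⟩ : ∃ t : ℝ≥0, (t : ℝ≥0∞) = ⨆ μ ∈ Mset T Φ α, hKS T μ :=
    ⟨_, ENNReal.coe_toNNReal htop'⟩
  rw [← ht] at hu1
  have htu : t < u' := by exact_mod_cast hu1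
  have hus : u' < s' := by exact_mod_cast hu2
  have husR : (u' : ℝ) < s' := by exact_mod_cast hus
  have hs0 : (0 : ℝ) < s' := lt_of_le_of_lt u'.coe_nonneg husR
  obtain ⟨k, ctr, hnet⟩ : ∃ (k : ℕ) (ctr : Fin k → X), ∀ y, ∃ i, dist y (ctr i) < ε / 4 := by
    obtain ⟨S, hS⟩ := (isCompact_univ (X := X)).elim_finite_subcover
      (fun y : X => Metric.ball y (ε / 4)) (fun y => Metric.isOpen_ball)
      (fun y _ => Set.mem_iUnion.2 ⟨y, Metric.mem_ball_self (by linarith)⟩)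
    refine ⟨S.card, fun i => (S.equivFin.symm i : X), fun y => ?_⟩
    obtain ⟨c, hc, hyc⟩ := Set.mem_iUnion₂.1 (hS (Set.mem_univ y))
    exact ⟨S.equivFin ⟨c, hc⟩, by simpa using hyc⟩
  refine iInf₂_le s' ?_
  unfold bowenH
  refine le_antisymm (iSup_le fun N => ?_) zero_le
  let κ := Σ m : ℕ, {q : (Fin (m + 1) → Fin k) → ℚ // (∀ b, (0 : ℝ) < q b) ∧ ∑ b, (q b : ℝ) ≤ 1}
  have hsub : Eset T Φ α ⊆
      ⋃ c : κ, crossSet T ctr ε (c.1 + 1) (fun b => (c.2.1 b : ℝ)) u' := by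
    intro x hx
    obtain ⟨μ, hμ, hlim⟩ := exists_limit T hT r Φ hΦ α x hx
    have hle : hKS T (μ : Measure X) ≤ t := by
      rw [ht]
      exact le_iSup₂_of_le (μ : Measure X) hμ le_rfl
    obtain ⟨m, q, hq0, hqs, hmem⟩ :=
      mem_crossSet T hT ctr ε hε hnet μ hμ.2.1 x hlim t u' htu hle
    exact Set.mem_iUnion.2 ⟨⟨m, q, hq0, hqs⟩, hmem⟩
  refine (bowenHn_mono T hsub s' ε N).trans ((bowenHn_iUnion_le T s' ε hs0 N _).trans ?_)
  refine le_of_eq (ENNReal.tsum_eq_zero.2 fun c => ?_)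
  exact bowenHn_crossSet T ctr ε (c.1 + 1) (Nat.succ_pos _) _ c.2.2.1 c.2.2.2 u' s'
    u'.coe_nonneg husR N
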